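/- arXiv:2309.05145 — 12 statements merged into one kernel-verified Lean document; each statement's English description precedes it below -/
import Mathlib

section
/- Let n ≥ 1 be an integer, let s_1, …, s_n be real numbers, and let k be an integer with 1 ≤ k ≤ n. Then the sum of the k largest entries satisfies Σ_{i=1}^{k} s_{[i]} = inf_{λ ∈ ℝ} ( k·λ + Σ_{i=1}^{n} [s_i − λ]_+ ). -/
/-- For real numbers `s 0, …, s (n-1)` (`n ≥ 1`) and `1 ≤ k ≤ n`, the sum of
the `k` largest entries equals `inf_{λ ∈ ℝ} (k·λ + Σ_i [s i − λ]_+)`.  Here the sorted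
(non-increasing) rearrangement of `s` is given by `t` together with a permutation `σ`,
so that `t (i-1)` is the `i`-th largest entry `s_{[i]}` (1-indexed), and `[a]_+ = max a 0`. -/
theorem sum_top_k_eq_iInf (n k : ℕ) (hn : 1 ≤ n) (hk1 : 1 ≤ k) (hkn : k ≤ n)
    (s t : Fin n → ℝ) (σ : Equiv.Perm (Fin n))
    (hperm : ∀ i, t i = s (σ i)) (hsort : Antitone t) :
    ∑ i ∈ Finset.univ.filter (fun i : Fin n => (i : ℕ) < k), t i
      = ⨅ l : ℝ, ((k : ℝ) * l + ∑ i : Fin n, max (s i - l) 0) := by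
  have hsum : ∀ l : ℝ, ∑ i : Fin n, max (s i - l) 0 = ∑ i : Fin n, max (t i - l) 0 := by
    intro l
    simp only [hperm]
    exact (Equiv.sum_comp σ (fun i => max (s i - l) 0)).symm
  have hcard : (Finset.univ.filter (fun i : Fin n => (i : ℕ) < k)).card = k := by
    rw [Fin.card_filter_val_lt]
    omega
  have hkl : ∀ l : ℝ, (k : ℝ) * l
      = ∑ i ∈ Finset.univ.filter (fun i : Fin n => (i : ℕ) < k), l := by
    intro l
    rw [Finset.sum_const, hcard, nsmul_eq_mul]
  have hle : ∀ l : ℝ, ∑ i ∈ Finset.univ.filter (fun i : Fin n => (i : ℕ) < k), t i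
      ≤ (k : ℝ) * l + ∑ i : Fin n, max (s i - l) 0 := by
    intro l
    rw [hsum, hkl]
    calc ∑ i ∈ Finset.univ.filter (fun i : Fin n => (i : ℕ) < k), t i
        ≤ ∑ i ∈ Finset.univ.filter (fun i : Fin n => (i : ℕ) < k), (l + max (t i - l) 0) := by
          apply Finset.sum_le_sum
          intro i _
          linarith [le_max_left (t i - l) 0]
      _ ≤ _ := by
          rw [Finset.sum_add_distrib]
          refine add_le_add le_rfl ?_
          exact Finset.sum_le_sum_of_subset_of_nonneg (Finset.filter_subset _ _)
            (fun i _ _ => le_max_right _ _)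
  apply le_antisymm
  · exact le_ciInf hle
  · have hlt : k - 1 < n := by omega
    refine (ciInf_le ⟨_, Set.forall_mem_range.2 hle⟩ (t ⟨k - 1, hlt⟩)).trans (le_of_eq ?_)
    rw [hsum, hkl, ← Finset.sum_filter_add_sum_filter_not Finset.univ
      (fun i : Fin n => (i : ℕ) < k) (fun i => max (t i - t ⟨k - 1, hlt⟩) 0)]
    rw [← add_assoc, ← Finset.sum_add_distrib]
    have h0 : ∑ i ∈ Finset.univ.filter (fun i : Fin n => ¬ (i : ℕ) < k),
        max (t i - t ⟨k - 1, hlt⟩) 0 = 0 := by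
      apply Finset.sum_eq_zero
      intro i hi
      have hi' : ¬ (i : ℕ) < k := (Finset.mem_filter.1 hi).2
      have : t i ≤ t ⟨k - 1, hlt⟩ := hsort (by rw [Fin.le_def]; simp only; omega)
      exact max_eq_right (by linarith)
    rw [h0, add_zero]
    apply Finset.sum_congr rfl
    intro i hi
    have hi' : (i : ℕ) < k := (Finset.mem_filter.1 hi).2
    have : t ⟨k - 1, hlt⟩ ≤ t i := hsort (by rw [Fin.le_def]; simp only; omega)
    rw [max_eq_left (by linarith)]
    ring
end

section
/- Let n ≥ 1 be an integer, let s_1, …, s_n be real numbers, and let k be an integer with 1 ≤ k ≤ n. Then λ = s_{[k]} minimizes λ ↦ k·λ + Σ_{i=1}^{n} [s_i − λ]_+ over ℝ: one has k·s_{[k]} + Σ_{i=1}^{n} [s_i − s_{[k]}]_+ = Σ_{i=1}^{k} s_{[i]}, and Σ_{i=1}^{k} s_{[i]} ≤ k·λ + Σ_{i=1}^{n} [s_i − λ]_+ for every λ ∈ ℝ. -/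
/-- For real numbers `s 0, …, s (n-1)` (`n ≥ 1`) and `1 ≤ k ≤ n`, the value
`λ = s_{[k]}` minimizes `λ ↦ k·λ + Σ_i [s i − λ]_+` over `ℝ`: the objective at `s_{[k]}`
equals the sum of the `k` largest entries, and this sum is a lower bound of the objective
for every real `λ`.  The sorted (non-increasing) rearrangement of `s` is given by `t`
together with a permutation `σ`, so `s_{[k]} = t ⟨k-1, _⟩` and `[a]_+ = max a 0`. -/
theorem top_k_minimizer (n k : ℕ) (hn : 1 ≤ n) (hk1 : 1 ≤ k) (hkn : k ≤ n)
    (s t : Fin n → ℝ) (σ : Equiv.Perm (Fin n))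
    (hperm : ∀ i, t i = s (σ i)) (hsort : Antitone t) :
    ((k : ℝ) * t ⟨k - 1, by omega⟩ + ∑ i : Fin n, max (s i - t ⟨k - 1, by omega⟩) 0
        = ∑ i ∈ Finset.univ.filter (fun i : Fin n => (i : ℕ) < k), t i)
    ∧ ∀ l : ℝ, ∑ i ∈ Finset.univ.filter (fun i : Fin n => (i : ℕ) < k), t i
        ≤ (k : ℝ) * l + ∑ i : Fin n, max (s i - l) 0 := by
  have hre : ∀ l : ℝ, ∑ i : Fin n, max (s i - l) 0 = ∑ i : Fin n, max (t i - l) 0 := by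
    intro l
    rw [← Equiv.sum_comp σ (fun i => max (s i - l) 0)]
    simp only [hperm]
  have hcard : (Finset.univ.filter (fun i : Fin n => (i : ℕ) < k)).card = k := by
    rw [Fin.card_filter_val_lt]
    omega
  have hkl : ∀ l : ℝ, (k : ℝ) * l = ∑ i : Fin n, if (i : ℕ) < k then l else 0 := by
    intro l
    rw [← Finset.sum_filter, Finset.sum_const, hcard, nsmul_eq_mul]
  constructor
  · rw [hre, hkl, Finset.sum_filter, ← Finset.sum_add_distrib]
    refine Finset.sum_congr rfl fun i _ => ?_
    split_ifs with h
    · have : t ⟨k - 1, by omega⟩ ≤ t i := hsort (by rw [Fin.le_def]; simp only; omega)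
      rw [max_eq_left (by linarith)]
      ring
    · have : t i ≤ t ⟨k - 1, by omega⟩ := hsort (by rw [Fin.le_def]; simp only; omega)
      rw [max_eq_right (by linarith)]
      ring
  · intro l
    rw [hre, hkl, Finset.sum_filter, ← Finset.sum_add_distrib]
    refine Finset.sum_le_sum fun i _ => ?_
    split_ifs with h
    · linarith [le_max_left (t i - l) 0]
    · linarith [le_max_right (t i - l) 0]
end

section
/- Let n ≥ 1 be an integer, let s_1, …, s_n be real numbers, and let m be an integer with 0 ≤ m ≤ n. Then the sum of the n − m smallest entries satisfies Σ_{i=m+1}^{n} s_{[i]} = sup_{λ ∈ ℝ} ( (n − m)·λ − Σ_{i=1}^{n} [λ − s_i]_+ ). -/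
theorem card_aux (n m : ℕ) (hmn : m ≤ n) :
    ((Finset.univ.filter (fun i : Fin n => m ≤ (i : ℕ))).card : ℝ) = (n : ℝ) - m := by
  have h : (Finset.univ.filter (fun i : Fin n => m ≤ (i : ℕ))).card = n - m := by
    rw [← Finset.card_map Fin.valEmbedding, ← Nat.card_Ico]
    congr 1
    ext x
    simp only [Finset.mem_map, Finset.mem_filter, Finset.mem_univ, true_and,
      Fin.valEmbedding_apply, Finset.mem_Ico]
    constructor
    · rintro ⟨a, h1, rfl⟩
      exact ⟨h1, a.2⟩
    · rintro ⟨h1, h2⟩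
      exact ⟨⟨x, h2⟩, h1, rfl⟩
  rw [h, Nat.cast_sub hmn]

/-- For real numbers `s 0, …, s (n-1)` (`n ≥ 1`) and `0 ≤ m ≤ n`, the sum of
the `n − m` smallest entries satisfies
`Σ_{i=m+1}^{n} s_{[i]} = sup_{λ ∈ ℝ} ((n − m)·λ − Σ_i [λ − s i]_+)`.
The sorted (non-increasing) rearrangement of `s` is given by `t` together with a
permutation `σ`, so `Σ_{i=m+1}^{n} s_{[i]}` is the sum of `t i` over 0-indexed `i ≥ m`,
and `[a]_+ = max a 0`. -/
theorem sum_bottom_eq_iSup (n m : ℕ) (hn : 1 ≤ n) (hmn : m ≤ n)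
    (s t : Fin n → ℝ) (σ : Equiv.Perm (Fin n))
    (hperm : ∀ i, t i = s (σ i)) (hsort : Antitone t) :
    ∑ i ∈ Finset.univ.filter (fun i : Fin n => m ≤ (i : ℕ)), t i
      = ⨆ l : ℝ, (((n : ℝ) - (m : ℝ)) * l - ∑ i : Fin n, max (l - s i) 0) := by
  have hs : ∀ l : ℝ, ∑ i : Fin n, max (l - s i) 0 = ∑ i : Fin n, max (l - t i) 0 := by
    intro l
    simp only [hperm]
    exact (Equiv.sum_comp σ (fun i => max (l - s i) 0)).symm
  have hl : ∀ l : ℝ, ((n : ℝ) - (m : ℝ)) * l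
      - ∑ i ∈ Finset.univ.filter (fun i : Fin n => m ≤ (i : ℕ)), t i
      = ∑ i : Fin n, if m ≤ (i : ℕ) then l - t i else 0 := by
    intro l
    rw [← Finset.sum_filter, Finset.sum_sub_distrib, Finset.sum_const, nsmul_eq_mul,
      card_aux n m hmn]
  have hub : ∀ l : ℝ, ((n : ℝ) - (m : ℝ)) * l - ∑ i : Fin n, max (l - s i) 0
      ≤ ∑ i ∈ Finset.univ.filter (fun i : Fin n => m ≤ (i : ℕ)), t i := by
    intro l
    have h : (∑ i : Fin n, if m ≤ (i : ℕ) then l - t i else 0)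
        ≤ ∑ i : Fin n, max (l - t i) 0 := by
      apply Finset.sum_le_sum
      intro i _
      split_ifs
      · exact le_max_left _ _
      · exact le_max_right _ _
    rw [hs]
    linarith [hl l]
  obtain ⟨l, h1, h2⟩ : ∃ l : ℝ, (∀ i : Fin n, m ≤ (i : ℕ) → t i ≤ l) ∧
      (∀ i : Fin n, (i : ℕ) < m → l ≤ t i) := by
    rcases hmn.lt_or_eq with h | h
    · exact ⟨t ⟨m, h⟩, fun i hi => hsort (Fin.le_def.2 hi),
        fun i hi => hsort (Fin.le_def.2 hi.le)⟩
    · refine ⟨t ⟨n - 1, by omega⟩, fun i hi => ?_, fun i hi => hsort (Fin.le_def.2 ?_)⟩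
      · have := i.2
        omega
      · have := i.2
        simp only
        omega
  apply le_antisymm
  · refine le_ciSup_of_le ⟨_, by rintro _ ⟨l, rfl⟩; exact hub l⟩ l ?_
    have h : (∑ i : Fin n, if m ≤ (i : ℕ) then l - t i else 0)
        = ∑ i : Fin n, max (l - t i) 0 := by
      apply Finset.sum_congr rfl
      intro i _
      split_ifs with hi
      · exact (max_eq_left (by linarith [h1 i hi])).symm
      · exact (max_eq_right (by linarith [h2 i (not_le.1 hi)])).symm
    rw [hs]
    linarith [hl l]
  · exact ciSup_le hub
end

section
/- Let n ≥ 1 be an integer, let s_1, …, s_n be real numbers, and let m be an integer with 1 ≤ m ≤ n. Then λ = s_{[m]} maximizes λ ↦ (n − m)·λ − Σ_{i=1}^{n} [λ − s_i]_+ over ℝ: one has (n − m)·s_{[m]} − Σ_{i=1}^{n} [s_{[m]} − s_i]_+ = Σ_{i=m+1}^{n} s_{[i]}, and (n − m)·λ − Σ_{i=1}^{n} [λ − s_i]_+ ≤ Σ_{i=m+1}^{n} s_{[i]} for every λ ∈ ℝ. -/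
/-- For real numbers `s 0, …, s (n-1)` (`n ≥ 1`) and `1 ≤ m ≤ n`, the value
`λ = s_{[m]}` maximizes `λ ↦ (n − m)·λ − Σ_i [λ − s i]_+` over `ℝ`: the objective at
`s_{[m]}` equals the sum of the `n − m` smallest entries `Σ_{i=m+1}^{n} s_{[i]}`, and this
sum is an upper bound of the objective for every real `λ`.  The sorted (non-increasing)
rearrangement of `s` is given by `t` together with a permutation `σ`, so
`s_{[m]} = t ⟨m-1, _⟩`, and `[a]_+ = max a 0`. -/
theorem bottom_maximizer (n m : ℕ) (hn : 1 ≤ n) (hm1 : 1 ≤ m) (hmn : m ≤ n)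
    (s t : Fin n → ℝ) (σ : Equiv.Perm (Fin n))
    (hperm : ∀ i, t i = s (σ i)) (hsort : Antitone t) :
    (((n : ℝ) - (m : ℝ)) * t ⟨m - 1, by omega⟩
        - ∑ i : Fin n, max (t ⟨m - 1, by omega⟩ - s i) 0
        = ∑ i ∈ Finset.univ.filter (fun i : Fin n => m ≤ (i : ℕ)), t i)
    ∧ ∀ l : ℝ, ((n : ℝ) - (m : ℝ)) * l - ∑ i : Fin n, max (l - s i) 0
        ≤ ∑ i ∈ Finset.univ.filter (fun i : Fin n => m ≤ (i : ℕ)), t i := by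
  have hs : ∀ l : ℝ, ∑ i : Fin n, max (l - s i) 0 = ∑ i : Fin n, max (l - t i) 0 := by
    intro l
    rw [← Equiv.sum_comp σ (fun i => max (l - s i) 0)]
    simp only [hperm]
  have hcard : ((n : ℝ) - (m : ℝ))
      = ∑ i : Fin n, (if m ≤ (i : ℕ) then (1 : ℝ) else 0) := by
    rw [Fin.sum_univ_eq_sum_range (fun i => if m ≤ i then (1 : ℝ) else 0) n,
      ← Finset.sum_filter]
    have h : (Finset.range n).filter (fun i => m ≤ i) = Finset.Ico m n := by
      ext i
      simp only [Finset.mem_filter, Finset.mem_range, Finset.mem_Ico]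
      omega
    rw [h]
    simp [Nat.cast_sub hmn]
  constructor
  · rw [hs, hcard, Finset.sum_mul, ← Finset.sum_sub_distrib, Finset.sum_filter]
    refine Finset.sum_congr rfl fun i _ => ?_
    by_cases h : m ≤ (i : ℕ)
    · have h1 : t i ≤ t ⟨m - 1, by omega⟩ := hsort (Fin.le_def.2 (by simp only; omega))
      rw [if_pos h, if_pos h, max_eq_left (by linarith)]
      ring
    · have h1 : t ⟨m - 1, by omega⟩ ≤ t i := hsort (Fin.le_def.2 (by simp only; omega))
      rw [if_neg h, if_neg h, max_eq_right (by linarith)]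
      ring
  · intro l
    rw [hs, hcard, Finset.sum_mul, ← Finset.sum_sub_distrib, Finset.sum_filter]
    refine Finset.sum_le_sum fun i _ => ?_
    have h1 := le_max_left (l - t i) 0
    have h2 := le_max_right (l - t i) 0
    split_ifs <;> linarith
end

section
/- Let n ≥ 1 be an integer, let s_1, …, s_n be real numbers, and let m, k be integers with 0 ≤ m < k ≤ n. For a subset T of {1, …, n} with |T| = n − m, let topsum(T) denote the sum of the k − m largest entries (counted with multiplicity) of the family (s_i)_{i ∈ T}. Then Σ_{i=m+1}^{k} s_{[i]} is the minimum of topsum(T) over all subsets T of {1, …, n} of cardinality n − m: every such T satisfies topsum(T) ≥ Σ_{i=m+1}^{k} s_{[i]}, and equality holds for some subset T of cardinality n − m. -/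
/-- `topsum s T j` is the sum of the `j` largest entries (counted with multiplicity) of
the family `(s i)_{i ∈ T}`: equivalently, the supremum (here: maximum) of `Σ_{i ∈ U} s i`
over all subsets `U ⊆ T` with `|U| = j`. -/
noncomputable def topsum {n : ℕ} (s : Fin n → ℝ) (T : Finset (Fin n)) (j : ℕ) : ℝ :=
  sSup ((fun U : Finset (Fin n) => ∑ i ∈ U, s i) '' {U : Finset (Fin n) | U ⊆ T ∧ U.card = j})

theorem aux_emb_le {n N : ℕ} (e : Fin N → Fin n) (he : StrictMono e) :
    ∀ (d : ℕ) (j : Fin N), (j : ℕ) + d + 1 = N → (e j : ℕ) + d + 1 ≤ n := by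
  intro d
  induction d with
  | zero => intro j _; have := (e j).2; omega
  | succ d ih =>
    intro j hj
    have h1 := ih ⟨j + 1, by omega⟩ (by simp only; omega)
    have h2 : e j < e ⟨j + 1, by omega⟩ := he (by simp [Fin.lt_def])
    rw [Fin.lt_def] at h2
    omega

theorem aux_sum_range {n m k : ℕ} (hmk : m < k) (hkn : k ≤ n) (t : Fin n → ℝ) :
    ∑ i ∈ Finset.univ.filter (fun i : Fin n => m ≤ (i : ℕ) ∧ (i : ℕ) < k), t i
      = ∑ j : Fin (k - m), t ⟨m + j, by omega⟩ := by
  symm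
  refine Finset.sum_bij (fun j _ => ⟨m + j, by omega⟩) ?_ ?_ ?_ ?_
  · intro j _
    simp
    omega
  · intro a _ b _ h
    simp at h
    exact Fin.ext h
  · intro b hb
    simp at hb
    exact ⟨⟨b - m, by omega⟩, Finset.mem_univ _, by ext; simp; omega⟩
  · intro j _
    rfl

theorem aux_bdd {n : ℕ} (s : Fin n → ℝ) (T : Finset (Fin n)) (j : ℕ) :
    BddAbove ((fun U : Finset (Fin n) => ∑ i ∈ U, s i) ''
      {U : Finset (Fin n) | U ⊆ T ∧ U.card = j}) :=
  ((Set.toFinite _).image _).bddAbove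

theorem aux_card {n m k : ℕ} (hmk : m < k) (hkn : k ≤ n) :
    (Finset.univ.filter (fun i : Fin n => m ≤ (i : ℕ) ∧ (i : ℕ) < k)).card = k - m := by
  have h := aux_sum_range hmk hkn (fun _ => (1 : ℝ))
  simp only [Finset.sum_const, nsmul_eq_mul, mul_one, Finset.card_univ, Fintype.card_fin] at h
  exact_mod_cast h

theorem aux_upper {n m k : ℕ} (hmk : m < k) (hkn : k ≤ n) (t : Fin n → ℝ) (ht : Antitone t)
    (V : Finset (Fin n)) (hV : ∀ i ∈ V, m ≤ (i : ℕ)) (hc : V.card = k - m) :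
    ∑ i ∈ V, t i ≤
      ∑ i ∈ Finset.univ.filter (fun i : Fin n => m ≤ (i : ℕ) ∧ (i : ℕ) < k), t i := by
  have hA := aux_card (n := n) hmk hkn
  set A := Finset.univ.filter (fun i : Fin n => m ≤ (i : ℕ) ∧ (i : ℕ) < k) with hAdef
  set c := t ⟨k - 1, by omega⟩ with hcdef
  have key : ∑ i ∈ V, (t i - c) ≤ ∑ i ∈ A, (t i - c) := by
    rw [← Finset.sum_inter_add_sum_sdiff V A, ← Finset.sum_inter_add_sum_sdiff A V,
      Finset.inter_comm A V]
    have h1 : ∑ i ∈ V \ A, (t i - c) ≤ 0 := by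
      apply Finset.sum_nonpos
      intro i hi
      simp only [Finset.mem_sdiff, hAdef, Finset.mem_filter, Finset.mem_univ, true_and] at hi
      have := hV i hi.1
      have h2 : t i ≤ c := ht (by rw [Fin.le_def]; simp only; omega)
      linarith
    have h2 : 0 ≤ ∑ i ∈ A \ V, (t i - c) := by
      apply Finset.sum_nonneg
      intro i hi
      simp only [Finset.mem_sdiff, hAdef, Finset.mem_filter, Finset.mem_univ, true_and] at hi
      have h2 : c ≤ t i := ht (by rw [Fin.le_def]; simp only; omega)
      linarith
    linarith
  simp only [Finset.sum_sub_distrib, Finset.sum_const, hc, hA] at key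
  linarith

/-- For real numbers `s 0, …, s (n-1)` (`n ≥ 1`) and `0 ≤ m < k ≤ n`, the
ranked-range sum `Σ_{i=m+1}^{k} s_{[i]}` is the minimum, over all subsets `T` of the index
set with `|T| = n − m`, of the sum of the `k − m` largest entries of `(s i)_{i ∈ T}`:
every such `T` satisfies `topsum s T (k−m) ≥ Σ_{i=m+1}^{k} s_{[i]}`, and equality holds for
some `T` of cardinality `n − m`.  The sorted (non-increasing) rearrangement of `s` is given
by `t` together with a permutation `σ`, so `Σ_{i=m+1}^{k} s_{[i]}` is the sum of `t i` over
0-indexed `i` with `m ≤ i < k`. -/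
theorem ranked_range_min_over_subsets (n m k : ℕ) (hn : 1 ≤ n) (hmk : m < k) (hkn : k ≤ n)
    (s t : Fin n → ℝ) (σ : Equiv.Perm (Fin n))
    (hperm : ∀ i, t i = s (σ i)) (hsort : Antitone t) :
    (∀ T : Finset (Fin n), T.card = n - m →
        ∑ i ∈ Finset.univ.filter (fun i : Fin n => m ≤ (i : ℕ) ∧ (i : ℕ) < k), t i
          ≤ topsum s T (k - m))
    ∧ ∃ T : Finset (Fin n), T.card = n - m ∧
        topsum s T (k - m)
          = ∑ i ∈ Finset.univ.filter (fun i : Fin n => m ≤ (i : ℕ) ∧ (i : ℕ) < k), t i := by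
  have hs : ∀ U : Finset (Fin n), ∑ i ∈ U.map σ.toEmbedding, s i = ∑ i ∈ U, t i := by
    intro U
    rw [Finset.sum_map]
    exact Finset.sum_congr rfl (fun i _ => (hperm i).symm)
  refine ⟨?_, ?_⟩
  · intro T hT
    have hT' : (T.map σ.symm.toEmbedding).card = n - m := by rw [Finset.card_map, hT]
    set e := (T.map σ.symm.toEmbedding).orderEmbOfFin hT' with he
    let g : Fin (k - m) ↪ Fin n :=
      (Fin.castLEEmb (show k - m ≤ n - m by omega)).trans e.toEmbedding
    have hg : ∀ j, g j = e ⟨j, by omega⟩ := fun j => rfl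
    have h1 : ∑ i ∈ Finset.univ.filter (fun i : Fin n => m ≤ (i : ℕ) ∧ (i : ℕ) < k), t i
        ≤ ∑ i ∈ Finset.univ.map g, t i := by
      rw [aux_sum_range hmk hkn, Finset.sum_map]
      refine Finset.sum_le_sum fun j _ => hsort ?_
      rw [hg, Fin.le_def]
      have := aux_emb_le e e.strictMono (n - m - 1 - j) ⟨j, by omega⟩ (by simp only; omega)
      simp only
      omega
    refine h1.trans ?_
    rw [← hs]
    refine le_csSup (aux_bdd s T (k - m)) ⟨_, ⟨?_, ?_⟩, rfl⟩
    · intro x hx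
      simp only [Finset.mem_map, Finset.mem_univ, true_and, exists_exists_eq_and] at hx
      obtain ⟨j, rfl⟩ := hx
      have := Finset.orderEmbOfFin_mem (T.map σ.symm.toEmbedding) hT' ⟨j, by omega⟩
      rw [← he, ← hg, Finset.mem_map] at this
      obtain ⟨y, hy, hyx⟩ := this
      rw [← hyx]
      simpa using hy
    · simp
  · have hcard : (Finset.univ.filter (fun i : Fin n => m ≤ (i : ℕ))).card = n - m := by
      rw [← aux_card (n := n) (show m < n by omega) le_rfl]
      congr 1
      ext i
      simp
    refine ⟨(Finset.univ.filter (fun i : Fin n => m ≤ (i : ℕ))).map σ.toEmbedding, ?_, ?_⟩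
    · rw [Finset.card_map, hcard]
    · refine IsGreatest.csSup_eq ⟨⟨_, ⟨?_, ?_⟩, hs _⟩, ?_⟩
      · apply Finset.map_subset_map.2
        intro i hi
        simp only [Finset.mem_filter, Finset.mem_univ, true_and] at hi ⊢
        exact hi.1
      · rw [Finset.card_map, aux_card hmk hkn]
      · rintro _ ⟨U, ⟨hU, hUc⟩, rfl⟩
        obtain ⟨V, hV, rfl⟩ := Finset.subset_map_iff.1 hU
        simp only [hs]
        refine aux_upper hmk hkn t hsort V (fun i hi => ?_) (by simpa using hUc)
        simpa using hV hi
end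

section
/- Let n ≥ 1 be an integer, let s_1, …, s_n be nonnegative real numbers, and let m, k be integers with 0 ≤ m < k ≤ n. For λ ∈ ℝ set t_i(λ) := [s_i − λ]_+ and let t(λ)_{[i]} be the i-th largest of t_1(λ), …, t_n(λ). Then the ranked-range sum satisfies Σ_{i=m+1}^{k} s_{[i]} = inf_{λ ∈ ℝ} ( (k − m)·λ + Σ_{i=m+1}^{n} t(λ)_{[i]} ), and the infimum is attained at λ = s_{[k]}. -/
/-- For nonnegative real numbers `s 0, …, s (n-1)` (`n ≥ 1`) and
`0 ≤ m < k ≤ n`, abbreviating `t_i(λ) = [s i − λ]_+` and writing `t(λ)_{[i]}` for the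
`i`-th largest of the `t_i(λ)`, the ranked-range sum satisfies
`Σ_{i=m+1}^{k} s_{[i]} = inf_{λ ∈ ℝ} ((k−m)·λ + Σ_{i=m+1}^{n} t(λ)_{[i]})`, and the
infimum is attained at `λ = s_{[k]}`.
The sorted (non-increasing) rearrangement of `s` is given by `t` together with a
permutation `σ`; since `u ↦ [u − λ]_+` is non-decreasing, the non-increasing sort of the
family `([s i − λ]_+)_i` is `i ↦ max (t i - λ) 0`, so
`Σ_{i=m+1}^{n} t(λ)_{[i]} = Σ_{i ≥ m} max (t i − λ) 0` (0-indexed) and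
`s_{[k]} = t ⟨k-1, _⟩`. -/
theorem ranked_range_eq_iInf (n m k : ℕ) (hn : 1 ≤ n) (hmk : m < k) (hkn : k ≤ n)
    (s t : Fin n → ℝ) (hs : ∀ i, 0 ≤ s i) (σ : Equiv.Perm (Fin n))
    (hperm : ∀ i, t i = s (σ i)) (hsort : Antitone t) :
    (∑ i ∈ Finset.univ.filter (fun i : Fin n => m ≤ (i : ℕ) ∧ (i : ℕ) < k), t i
        = ⨅ l : ℝ, (((k : ℝ) - (m : ℝ)) * l
            + ∑ i ∈ Finset.univ.filter (fun i : Fin n => m ≤ (i : ℕ)), max (t i - l) 0))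
    ∧ ((k : ℝ) - (m : ℝ)) * t ⟨k - 1, by omega⟩
          + (∑ i ∈ Finset.univ.filter (fun i : Fin n => m ≤ (i : ℕ)),
              max (t i - t ⟨k - 1, by omega⟩) 0)
        = ⨅ l : ℝ, (((k : ℝ) - (m : ℝ)) * l
            + ∑ i ∈ Finset.univ.filter (fun i : Fin n => m ≤ (i : ℕ)), max (t i - l) 0) := by
  have hcard : (Finset.univ.filter
      (fun i : Fin n => m ≤ (i : ℕ) ∧ (i : ℕ) < k)).card = k - m := by
    rw [← Nat.card_Ico m k, ← Finset.card_map Fin.valEmbedding]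
    congr 1
    ext a
    simp only [Finset.mem_map, Finset.mem_filter, Finset.mem_univ, true_and,
      Fin.valEmbedding_apply, Finset.mem_Ico]
    constructor
    · rintro ⟨i, hi, rfl⟩
      exact hi
    · intro ha
      exact ⟨⟨a, by omega⟩, ha, rfl⟩
  have hsum : ∀ l : ℝ, ∑ i ∈ Finset.univ.filter
      (fun i : Fin n => m ≤ (i : ℕ) ∧ (i : ℕ) < k), t i
      = ((k : ℝ) - (m : ℝ)) * l + ∑ i ∈ Finset.univ.filter
      (fun i : Fin n => m ≤ (i : ℕ) ∧ (i : ℕ) < k), (t i - l) := by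
    intro l
    rw [Finset.sum_sub_distrib, Finset.sum_const, hcard, nsmul_eq_mul, Nat.cast_sub hmk.le]
    ring
  have hsub : Finset.univ.filter (fun i : Fin n => m ≤ (i : ℕ) ∧ (i : ℕ) < k)
      ⊆ Finset.univ.filter (fun i : Fin n => m ≤ (i : ℕ)) := by
    intro i hi
    simp only [Finset.mem_filter, Finset.mem_univ, true_and] at hi ⊢
    exact hi.1
  have hle : ∀ l : ℝ, ∑ i ∈ Finset.univ.filter
      (fun i : Fin n => m ≤ (i : ℕ) ∧ (i : ℕ) < k), t i
      ≤ ((k : ℝ) - (m : ℝ)) * l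
        + ∑ i ∈ Finset.univ.filter (fun i : Fin n => m ≤ (i : ℕ)), max (t i - l) 0 := by
    intro l
    rw [hsum l]
    gcongr
    exact (Finset.sum_le_sum (fun i _ => le_max_left (t i - l) 0)).trans
      (Finset.sum_le_sum_of_subset_of_nonneg hsub (fun i _ _ => le_max_right _ _))
  have heq : ((k : ℝ) - (m : ℝ)) * t ⟨k - 1, by omega⟩
          + (∑ i ∈ Finset.univ.filter (fun i : Fin n => m ≤ (i : ℕ)),
              max (t i - t ⟨k - 1, by omega⟩) 0) = ∑ i ∈ Finset.univ.filter
      (fun i : Fin n => m ≤ (i : ℕ) ∧ (i : ℕ) < k), t i := by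
    rw [hsum (t ⟨k - 1, by omega⟩)]
    congr 1
    rw [← Finset.sum_subset hsub]
    · apply Finset.sum_congr rfl
      intro i hi
      simp only [Finset.mem_filter, Finset.mem_univ, true_and] at hi
      apply max_eq_left
      have : t ⟨k - 1, by omega⟩ ≤ t i := hsort (Fin.le_def.2 (by simp only; omega))
      linarith
    · intro i hi hi2
      simp only [Finset.mem_filter, Finset.mem_univ, true_and] at hi hi2
      apply max_eq_right
      have : t i ≤ t ⟨k - 1, by omega⟩ := hsort (Fin.le_def.2 (by simp only; omega))
      linarith
  have hmain : ∑ i ∈ Finset.univ.filter (fun i : Fin n => m ≤ (i : ℕ) ∧ (i : ℕ) < k), t i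
        = ⨅ l : ℝ, (((k : ℝ) - (m : ℝ)) * l
            + ∑ i ∈ Finset.univ.filter (fun i : Fin n => m ≤ (i : ℕ)), max (t i - l) 0) := by
    apply le_antisymm
    · exact le_ciInf hle
    · refine (ciInf_le ⟨∑ i ∈ Finset.univ.filter
        (fun i : Fin n => m ≤ (i : ℕ) ∧ (i : ℕ) < k), t i, ?_⟩ (t ⟨k - 1, by omega⟩)).trans heq.le
      rintro _ ⟨l, rfl⟩
      exact hle l
  exact ⟨hmain, heq.trans hmain⟩
end

section
/- Let n ≥ 1 be an integer, let s_1, …, s_n be nonnegative real numbers (the adversarial individual losses), and let m, k be integers with 0 ≤ m < k ≤ n. Then the average of ranked range losses satisfies (1/(k − m))·Σ_{i=m+1}^{k} s_{[i]} = inf_{λ ∈ ℝ} sup_{λ̂ ∈ ℝ} (1/(k − m))·Σ_{i=1}^{n} [ ((k − m)/n)·λ + ((n − m)/n)·λ̂ − [λ̂ − [s_i − λ]_+]_+ ]. -/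
/-- For nonnegative real numbers `s 0, …, s (n-1)` (`n ≥ 1`, the adversarial
individual losses) and `0 ≤ m < k ≤ n`, the average of ranked-range losses satisfies
`(1/(k−m))·Σ_{i=m+1}^{k} s_{[i]}
  = inf_{λ ∈ ℝ} sup_{λ̂ ∈ ℝ} (1/(k−m))·Σ_{i=1}^{n}
      ( ((k−m)/n)·λ + ((n−m)/n)·λ̂ − [λ̂ − [s i − λ]_+]_+ )`.
The sorted (non-increasing) rearrangement of `s` is given by `t` together with a
permutation `σ`, so `Σ_{i=m+1}^{k} s_{[i]}` is the sum of `t i` over 0-indexed `i` with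
`m ≤ i < k`, and `[a]_+ = max a 0`. -/
theorem orat_average_eq_iInf_iSup (n m k : ℕ) (hn : 1 ≤ n) (hmk : m < k) (hkn : k ≤ n)
    (s t : Fin n → ℝ) (hs : ∀ i, 0 ≤ s i) (σ : Equiv.Perm (Fin n))
    (hperm : ∀ i, t i = s (σ i)) (hsort : Antitone t) :
    ((k : ℝ) - (m : ℝ))⁻¹
        * ∑ i ∈ Finset.univ.filter (fun i : Fin n => m ≤ (i : ℕ) ∧ (i : ℕ) < k), t i
      = ⨅ l : ℝ, ⨆ lh : ℝ, ((k : ℝ) - (m : ℝ))⁻¹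
          * ∑ i : Fin n,
              (((k : ℝ) - (m : ℝ)) / (n : ℝ) * l + ((n : ℝ) - (m : ℝ)) / (n : ℝ) * lh
                - max (lh - max (s i - l) 0) 0) := by
  classical
  have hnR : (n : ℝ) ≠ 0 := by positivity
  have hc : 0 < ((k : ℝ) - (m : ℝ))⁻¹ := by
    apply inv_pos.mpr
    have : (m : ℝ) < k := by exact_mod_cast hmk
    linarith
  have hmn : m < n := by omega
  set A := Finset.univ.filter (fun i : Fin n => m ≤ (i : ℕ)) with hA
  set B := Finset.univ.filter (fun i : Fin n => m ≤ (i : ℕ) ∧ (i : ℕ) < k) with hB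
  have cardA : (A.card : ℝ) = n - m := by
    have : A = Finset.Ici (⟨m, hmn⟩ : Fin n) := by
      ext i; simp [hA, Fin.le_def]
    rw [this, Fin.card_Ici, Nat.cast_sub hmn.le]
  have cardB : (B.card : ℝ) = k - m := by
    have : B = Finset.Icc (⟨m, hmn⟩ : Fin n) ⟨k - 1, by omega⟩ := by
      ext i; simp only [hB, Finset.mem_filter, Finset.mem_univ, true_and, Finset.mem_Icc, Fin.le_def]
      omega
    rw [this, Fin.card_Icc]
    simp only
    rw [← Nat.cast_sub hmk.le]
    congr 1
    omega
  have hBA : B ⊆ A := by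
    intro i; simp only [hA, hB, Finset.mem_filter, Finset.mem_univ, true_and]; exact fun h => h.1
  let H : ℝ → ℝ := fun l => ((k : ℝ) - m) * l + ∑ i ∈ A, max (t i - l) 0
  have hG : ∀ l lh : ℝ, ∑ i : Fin n,
              (((k : ℝ) - (m : ℝ)) / (n : ℝ) * l + ((n : ℝ) - (m : ℝ)) / (n : ℝ) * lh
                - max (lh - max (s i - l) 0) 0)
      = ((k : ℝ) - m) * l + ((n : ℝ) - m) * lh - ∑ i : Fin n, max (lh - max (t i - l) 0) 0 := by
    intro l lh
    rw [Finset.sum_sub_distrib]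
    congr 1
    · rw [Finset.sum_const, Finset.card_univ, Fintype.card_fin, nsmul_eq_mul]
      field_simp
    · rw [← Equiv.sum_comp σ]
      simp only [hperm]
  have hle : ∀ l lh : ℝ, ((k : ℝ) - m) * l + ((n : ℝ) - m) * lh
      - ∑ i : Fin n, max (lh - max (t i - l) 0) 0 ≤ H l := by
    intro l lh
    have h1 : ∑ i ∈ A, (lh - max (t i - l) 0) ≤ ∑ i : Fin n, max (lh - max (t i - l) 0) 0 :=
      (Finset.sum_le_sum fun i _ => le_max_left _ _).trans
        (Finset.sum_le_sum_of_subset_of_nonneg (Finset.subset_univ _)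
          fun i _ _ => le_max_right _ _)
    rw [Finset.sum_sub_distrib, Finset.sum_const, nsmul_eq_mul, cardA] at h1
    simp only [H]
    linarith
  have heq : ∀ l : ℝ, ((k : ℝ) - m) * l + ((n : ℝ) - m) * (max (t ⟨m, hmn⟩ - l) 0)
      - ∑ i : Fin n, max (max (t ⟨m, hmn⟩ - l) 0 - max (t i - l) 0) 0 = H l := by
    intro l
    have h1 : ∑ i ∈ A, (max (t ⟨m, hmn⟩ - l) 0 - max (t i - l) 0)
        = ∑ i : Fin n, max (max (t ⟨m, hmn⟩ - l) 0 - max (t i - l) 0) 0 := by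
      rw [hA, Finset.sum_filter]
      refine Finset.sum_congr rfl fun i _ => ?_
      split_ifs with h
      · have h2 : t i ≤ t ⟨m, hmn⟩ := hsort (Fin.le_def.mpr h)
        have := max_le_max_right 0 (sub_le_sub_right h2 l)
        exact (max_eq_left (sub_nonneg.mpr this)).symm
      · have h2 : t ⟨m, hmn⟩ ≤ t i := hsort (Fin.le_def.mpr (by simp only; omega))
        have := max_le_max_right 0 (sub_le_sub_right h2 l)
        exact (max_eq_right (sub_nonpos.mpr this)).symm
    rw [Finset.sum_sub_distrib, Finset.sum_const, nsmul_eq_mul, cardA] at h1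
    simp only [H]
    linarith
  have hsup : ∀ l : ℝ, (⨆ lh : ℝ, ((k : ℝ) - (m : ℝ))⁻¹
          * ∑ i : Fin n,
              (((k : ℝ) - (m : ℝ)) / (n : ℝ) * l + ((n : ℝ) - (m : ℝ)) / (n : ℝ) * lh
                - max (lh - max (s i - l) 0) 0)) = ((k : ℝ) - (m : ℝ))⁻¹ * H l := by
    intro l
    simp only [hG]
    have hb : ∀ lh : ℝ, ((k : ℝ) - (m : ℝ))⁻¹ * (((k : ℝ) - m) * l + ((n : ℝ) - m) * lh
        - ∑ i : Fin n, max (lh - max (t i - l) 0) 0) ≤ ((k : ℝ) - (m : ℝ))⁻¹ * H l :=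
      fun lh => mul_le_mul_of_nonneg_left (hle l lh) hc.le
    apply le_antisymm (ciSup_le hb)
    refine le_ciSup_of_le ⟨_, Set.forall_mem_range.mpr hb⟩ (max (t ⟨m, hmn⟩ - l) 0) ?_
    rw [heq]
  simp only [hsup]
  have hlow : ∀ l : ℝ, ∑ i ∈ B, t i ≤ H l := by
    intro l
    have h1 : ∑ i ∈ B, (t i - l) ≤ ∑ i ∈ A, max (t i - l) 0 :=
      (Finset.sum_le_sum fun i _ => le_max_left _ _).trans
        (Finset.sum_le_sum_of_subset_of_nonneg hBA fun i _ _ => le_max_right _ _)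
    rw [Finset.sum_sub_distrib, Finset.sum_const, nsmul_eq_mul, cardB] at h1
    simp only [H]
    linarith
  have hatt : H (t ⟨k - 1, by omega⟩) = ∑ i ∈ B, t i := by
    have h1 : ∑ i ∈ B, (t i - t ⟨k - 1, by omega⟩)
        = ∑ i ∈ A, max (t i - t ⟨k - 1, by omega⟩) 0 := by
      rw [← Finset.sum_subset hBA]
      · refine Finset.sum_congr rfl fun i hi => ?_
        simp only [hB, Finset.mem_filter, Finset.mem_univ, true_and] at hi
        rw [max_eq_left]
        exact sub_nonneg.mpr (hsort (Fin.le_def.mpr (by simp only; omega)))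
      · intro i hi hi'
        simp only [hA, hB, Finset.mem_filter, Finset.mem_univ, true_and] at hi hi'
        rw [max_eq_right]
        exact sub_nonpos.mpr (hsort (Fin.le_def.mpr (by simp only; omega)))
    rw [Finset.sum_sub_distrib, Finset.sum_const, nsmul_eq_mul, cardB] at h1
    simp only [H]
    linarith
  have hb : ∀ l : ℝ, ((k : ℝ) - (m : ℝ))⁻¹ * ∑ i ∈ B, t i ≤ ((k : ℝ) - (m : ℝ))⁻¹ * H l :=
    fun l => mul_le_mul_of_nonneg_left (hlow l) hc.le
  apply le_antisymm (le_ciInf hb)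
  refine ciInf_le_of_le ⟨_, Set.forall_mem_range.mpr hb⟩ (t ⟨k - 1, by omega⟩) ?_
  rw [hatt]
end

section
/- Let n ≥ 1 be an integer, let s_1, …, s_n be nonnegative real numbers, and let m, k be integers with 1 ≤ m < k ≤ n. Define F(λ, λ̂) := (k − m)·λ + (n − m)·λ̂ − Σ_{i=1}^{n} [λ̂ − [s_i − λ]_+]_+, and set λ* := s_{[k]} and λ̂* := s_{[m]} − s_{[k]} (so λ̂* ≥ 0). Then: (i) F(λ*, λ̂) ≤ F(λ*, λ̂*) for every λ̂ ∈ ℝ; (ii) F(λ*, λ̂*) = Σ_{i=m+1}^{k} s_{[i]}; and (iii) for every λ ∈ ℝ, sup_{λ̂ ∈ ℝ} F(λ, λ̂) ≥ Σ_{i=m+1}^{k} s_{[i]}. -/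
/-- `oratF s m k l lh = (k−m)·l + (n−m)·lh − Σ_{i=1}^{n} [lh − [s i − l]_+]_+`,
where `[a]_+ = max a 0`. -/
noncomputable def oratF {n : ℕ} (s : Fin n → ℝ) (m k : ℕ) (l lh : ℝ) : ℝ :=
  ((k : ℝ) - (m : ℝ)) * l + ((n : ℝ) - (m : ℝ)) * lh
    - ∑ i : Fin n, max (lh - max (s i - l) 0) 0

theorem orat_sum_const (n a b : ℕ) (hab : a ≤ b) (hbn : b ≤ n) (c : ℝ) :
    ∑ i : Fin n, (if a ≤ (i : ℕ) ∧ (i : ℕ) < b then c else 0) = ((b : ℝ) - (a : ℝ)) * c := by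
  rw [Fin.sum_univ_eq_sum_range (fun i : ℕ => if a ≤ i ∧ i < b then c else 0) n,
    ← Finset.sum_filter]
  have h : (Finset.range n).filter (fun i => a ≤ i ∧ i < b) = Finset.Ico a b := by
    ext i
    simp only [Finset.mem_filter, Finset.mem_range, Finset.mem_Ico]
    omega
  rw [h, Finset.sum_const, Nat.card_Ico, nsmul_eq_mul, Nat.cast_sub hab]

theorem orat_F_eq {n : ℕ} (m k : ℕ) (hmk : m < k) (hkn : k ≤ n)
    (s t : Fin n → ℝ) (σ : Equiv.Perm (Fin n)) (hperm : ∀ i, t i = s (σ i)) (l lh : ℝ) :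
    oratF s m k l lh = ∑ i : Fin n, ((if m ≤ (i : ℕ) ∧ (i : ℕ) < k then l else 0)
      + (if m ≤ (i : ℕ) ∧ (i : ℕ) < n then lh else 0) - max (lh - max (t i - l) 0) 0) := by
  rw [Finset.sum_sub_distrib, Finset.sum_add_distrib, orat_sum_const n m k hmk.le hkn,
    orat_sum_const n m n (hmk.le.trans hkn) le_rfl]
  unfold oratF
  congr 1
  rw [← Equiv.sum_comp σ]
  simp only [hperm]

/-- The value of the inner supremum. -/
noncomputable def oratG {n : ℕ} (t : Fin n → ℝ) (m k : ℕ) (l : ℝ) : ℝ :=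
  ∑ i : Fin n, ((if m ≤ (i : ℕ) ∧ (i : ℕ) < k then l else 0)
      + (if m ≤ (i : ℕ) then max (t i - l) 0 else 0))

theorem orat_F_le {n : ℕ} (m k : ℕ) (hmk : m < k) (hkn : k ≤ n)
    (s t : Fin n → ℝ) (σ : Equiv.Perm (Fin n)) (hperm : ∀ i, t i = s (σ i)) (l lh : ℝ) :
    oratF s m k l lh ≤ oratG t m k l := by
  rw [orat_F_eq m k hmk hkn s t σ hperm, oratG]
  refine Finset.sum_le_sum fun i _ => ?_
  have hi := i.2
  have h1 := le_max_left (lh - max (t i - l) 0) 0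
  have h2 := le_max_right (lh - max (t i - l) 0) 0
  by_cases h : m ≤ (i : ℕ)
  · simp only [h, hi, true_and, if_true]
    linarith
  · simp only [h, false_and, if_false]
    linarith

theorem orat_F_attained {n : ℕ} (m k : ℕ) (hm1 : 1 ≤ m) (hmk : m < k) (hkn : k ≤ n)
    (s t : Fin n → ℝ) (σ : Equiv.Perm (Fin n)) (hperm : ∀ i, t i = s (σ i))
    (hsort : Antitone t) (j : Fin n) (hj : (j : ℕ) = m - 1) (l : ℝ) :
    oratF s m k l (max (t j - l) 0) = oratG t m k l := by
  rw [orat_F_eq m k hmk hkn s t σ hperm, oratG]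
  refine Finset.sum_congr rfl fun i _ => ?_
  have hi := i.2
  by_cases h : m ≤ (i : ℕ)
  · have ht : t i ≤ t j := hsort (Fin.le_def.2 (by omega))
    have h3 : max (t i - l) 0 ≤ max (t j - l) 0 :=
      max_le_max (by linarith) le_rfl
    rw [max_eq_left (a := max (t j - l) 0 - max (t i - l) 0) (b := 0) (by linarith)]
    simp only [h, hi, true_and, if_true]
    ring
  · have ht : t j ≤ t i := hsort (Fin.le_def.2 (by omega))
    have h3 : max (t j - l) 0 ≤ max (t i - l) 0 :=
      max_le_max (by linarith) le_rfl
    rw [max_eq_right (a := max (t j - l) 0 - max (t i - l) 0) (b := 0) (by linarith)]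
    simp only [h, false_and, if_false]
    ring

/-- For nonnegative real numbers `s 0, …, s (n-1)` (`n ≥ 1`) and
`1 ≤ m < k ≤ n`, with `F(λ, λ̂) := (k−m)·λ + (n−m)·λ̂ − Σ_i [λ̂ − [s i − λ]_+]_+`,
`λ* := s_{[k]}` and `λ̂* := s_{[m]} − s_{[k]}` (so `λ̂* ≥ 0`):
(i) `F(λ*, λ̂) ≤ F(λ*, λ̂*)` for every `λ̂ ∈ ℝ`;
(ii) `F(λ*, λ̂*) = Σ_{i=m+1}^{k} s_{[i]}`;
(iii) for every `λ ∈ ℝ`, `sup_{λ̂ ∈ ℝ} F(λ, λ̂) ≥ Σ_{i=m+1}^{k} s_{[i]}`.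
The sorted (non-increasing) rearrangement of `s` is given by `t` together with a
permutation `σ`, so `s_{[k]} = t ⟨k-1, _⟩`, `s_{[m]} = t ⟨m-1, _⟩`, and
`Σ_{i=m+1}^{k} s_{[i]}` is the sum of `t i` over 0-indexed `i` with `m ≤ i < k`. -/
theorem orat_saddle_point (n m k : ℕ) (hn : 1 ≤ n) (hm1 : 1 ≤ m) (hmk : m < k) (hkn : k ≤ n)
    (s t : Fin n → ℝ) (hs : ∀ i, 0 ≤ s i) (σ : Equiv.Perm (Fin n))
    (hperm : ∀ i, t i = s (σ i)) (hsort : Antitone t) :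
    (0 ≤ t ⟨m - 1, by omega⟩ - t ⟨k - 1, by omega⟩)
    ∧ (∀ lh : ℝ, oratF s m k (t ⟨k - 1, by omega⟩) lh
        ≤ oratF s m k (t ⟨k - 1, by omega⟩) (t ⟨m - 1, by omega⟩ - t ⟨k - 1, by omega⟩))
    ∧ (oratF s m k (t ⟨k - 1, by omega⟩) (t ⟨m - 1, by omega⟩ - t ⟨k - 1, by omega⟩)
        = ∑ i ∈ Finset.univ.filter (fun i : Fin n => m ≤ (i : ℕ) ∧ (i : ℕ) < k), t i)
    ∧ ∀ l : ℝ, ∑ i ∈ Finset.univ.filter (fun i : Fin n => m ≤ (i : ℕ) ∧ (i : ℕ) < k), t i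
        ≤ ⨆ lh : ℝ, oratF s m k l lh := by
  have h0 : t ⟨k - 1, by omega⟩ ≤ t ⟨m - 1, by omega⟩ :=
    hsort (Fin.le_def.2 (by simp; omega))
  have hatt := orat_F_attained m k hm1 hmk hkn s t σ hperm hsort ⟨m - 1, by omega⟩ rfl
  have hle := orat_F_le m k hmk hkn s t σ hperm
  have hstar := hatt (t ⟨k - 1, by omega⟩)
  rw [max_eq_left (sub_nonneg.2 h0)] at hstar
  refine ⟨sub_nonneg.2 h0, fun lh => ?_, ?_, fun l => ?_⟩
  · rw [hstar]
    exact hle _ _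
  · rw [hstar, oratG, Finset.sum_filter]
    refine Finset.sum_congr rfl fun i _ => ?_
    by_cases h : m ≤ (i : ℕ)
    · by_cases h' : (i : ℕ) < k
      · have ht : t ⟨k - 1, by omega⟩ ≤ t i := hsort (Fin.le_def.2 (by simp; omega))
        rw [max_eq_left (sub_nonneg.2 ht)]
        simp [h, h']
      · have ht : t i ≤ t ⟨k - 1, by omega⟩ := hsort (Fin.le_def.2 (by simp; omega))
        rw [max_eq_right (sub_nonpos.2 ht)]
        simp [h']
    · simp [h]
  · have hb : BddAbove (Set.range fun lh : ℝ => oratF s m k l lh) :=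
      ⟨oratG t m k l, by rintro _ ⟨lh, rfl⟩; exact hle l lh⟩
    refine le_trans ?_ (le_ciSup hb (max (t ⟨m - 1, by omega⟩ - l) 0))
    simp only [hatt l]
    rw [oratG, Finset.sum_filter]
    refine Finset.sum_le_sum fun i _ => ?_
    have h1 := le_max_left (t i - l) 0
    have h2 := le_max_right (t i - l) 0
    by_cases h : m ≤ (i : ℕ)
    · by_cases h' : (i : ℕ) < k
      · simp only [h, h', and_self, if_true]
        linarith
      · simp only [h, h', and_false, if_true, if_false]
        linarith
    · simp [h]
end

section
/- Let n ≥ 1 be an integer, let s_1, …, s_n be real numbers, and let m, k be integers with 0 ≤ m < k ≤ n. Then inf_{λ ∈ ℝ}( k·λ + Σ_{i=1}^{n} [s_i − λ]_+ ) − inf_{λ̂ ∈ ℝ}( m·λ̂ + Σ_{i=1}^{n} [s_i − λ̂]_+ ) = Σ_{i=m+1}^{k} s_{[i]}. -/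
theorem aux_inf (n j : ℕ) (hn : 1 ≤ n) (hj : j ≤ n)
    (s t : Fin n → ℝ) (σ : Equiv.Perm (Fin n))
    (hperm : ∀ i, t i = s (σ i)) (hsort : Antitone t) :
    (⨅ l : ℝ, ((j : ℝ) * l + ∑ i : Fin n, max (s i - l) 0))
      = ∑ i : Fin n, if (i : ℕ) < j then t i else 0 := by
  have key : ∀ l : ℝ, (j : ℝ) * l + ∑ i : Fin n, max (s i - l) 0
      = ∑ i : Fin n, ((if (i : ℕ) < j then l else 0) + max (t i - l) 0) := by
    intro l
    rw [Finset.sum_add_distrib]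
    congr 1
    · rw [← Finset.sum_filter, Finset.sum_const, nsmul_eq_mul, Fin.card_filter_val_lt,
        min_eq_right hj]
    · rw [← Equiv.sum_comp σ]
      simp only [hperm]
  have low : ∀ l : ℝ, (∑ i : Fin n, if (i : ℕ) < j then t i else 0)
      ≤ (j : ℝ) * l + ∑ i : Fin n, max (s i - l) 0 := by
    intro l
    rw [key]
    apply Finset.sum_le_sum
    intro i _
    have h1 := le_max_left (t i - l) 0
    have h2 := le_max_right (t i - l) 0
    split_ifs <;> linarith
  apply le_antisymm
  · obtain ⟨l, h1, h2⟩ : ∃ l : ℝ, (∀ i : Fin n, (i : ℕ) < j → l ≤ t i) ∧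
        (∀ i : Fin n, ¬ (i : ℕ) < j → t i ≤ l) := by
      refine ⟨t ⟨j - 1, by omega⟩, fun i hi => hsort ?_, fun i hi => hsort ?_⟩ <;>
        simp only [Fin.le_def] <;> omega
    refine (ciInf_le ⟨∑ i : Fin n, if (i : ℕ) < j then t i else 0, ?_⟩ l).trans ?_
    · rintro _ ⟨l, rfl⟩
      exact low l
    · rw [key]
      apply Finset.sum_le_sum
      intro i _
      split_ifs with h
      · rw [max_eq_left (by linarith [h1 i h])]
        linarith
      · rw [max_eq_right (by linarith [h2 i h])]
        linarith
  · exact le_ciInf low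

/-- For real numbers `s 0, …, s (n-1)` (`n ≥ 1`) and `0 ≤ m < k ≤ n`,
`inf_{λ ∈ ℝ}(k·λ + Σ_i [s i − λ]_+) − inf_{λ̂ ∈ ℝ}(m·λ̂ + Σ_i [s i − λ̂]_+)
  = Σ_{i=m+1}^{k} s_{[i]}`.
The sorted (non-increasing) rearrangement of `s` is given by `t` together with a
permutation `σ`, so `Σ_{i=m+1}^{k} s_{[i]}` is the sum of `t i` over 0-indexed `i` with
`m ≤ i < k`, and `[a]_+ = max a 0`. -/
theorem ranked_range_as_inf_difference (n m k : ℕ) (hn : 1 ≤ n) (hmk : m < k) (hkn : k ≤ n)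
    (s t : Fin n → ℝ) (σ : Equiv.Perm (Fin n))
    (hperm : ∀ i, t i = s (σ i)) (hsort : Antitone t) :
    (⨅ l : ℝ, ((k : ℝ) * l + ∑ i : Fin n, max (s i - l) 0))
        - (⨅ lh : ℝ, ((m : ℝ) * lh + ∑ i : Fin n, max (s i - lh) 0))
      = ∑ i ∈ Finset.univ.filter (fun i : Fin n => m ≤ (i : ℕ) ∧ (i : ℕ) < k), t i := by
  rw [aux_inf n k hn hkn s t σ hperm hsort, aux_inf n m hn (by omega) s t σ hperm hsort,
    Finset.sum_filter, ← Finset.sum_sub_distrib]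
  apply Finset.sum_congr rfl
  intro i _
  split_ifs <;> first | omega | simp
end

section
/- Let E be a real normed vector space, x₀ ∈ E, ε > 0, and let B be the closed ball of radius ε centered at x₀. Let ℓ : ℝ → ℝ be continuous, non-increasing, and nonnegative with ℓ(t) → 0 as t → +∞, and let λ, λ̂ be reals with 0 ≤ λ < λ̂ and λ + λ̂ ≤ ℓ(0). Then the adversarial calibration condition at η = 1/2 holds: the infimum of C(f, 1/2) over all functions f : E → ℝ bounded on B is strictly smaller than the infimum of C(f, 1/2) over all functions f : E → ℝ bounded on B that satisfy inf_{x ∈ B} f(x) ≤ 0 ≤ sup_{x ∈ B} f(x). -/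
/-- The ORAT surrogate loss `φ(t) := λ̂ − [λ̂ − [ℓ(t) − λ]_+]_+`, where `[a]_+ = max a 0`. -/
noncomputable def oratLoss (ℓ : ℝ → ℝ) (lam lamhat t : ℝ) : ℝ :=
  lamhat - max (lamhat - max (ℓ t - lam) 0) 0

/-- For `f : E → ℝ` bounded on `B` and `η ∈ [0, 1]`, the inner conditional φ-risk is
`C(f, η) := η·φ(inf_{x ∈ B} f x) + (1 − η)·φ(−sup_{x ∈ B} f x)`. -/
noncomputable def innerRisk {E : Type*} (B : Set E)
    (ℓ : ℝ → ℝ) (lam lamhat : ℝ) (f : E → ℝ) (η : ℝ) : ℝ :=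
  η * oratLoss ℓ lam lamhat (sInf (f '' B)) +
    (1 - η) * oratLoss ℓ lam lamhat (-sSup (f '' B))

/-- Let `E` be a real normed vector space, `B` the closed ball of radius
`ε > 0` around `x₀`, `ℓ : ℝ → ℝ` continuous, non-increasing and nonnegative with
`ℓ(t) → 0` as `t → +∞`, and `0 ≤ λ < λ̂` with `λ + λ̂ ≤ ℓ(0)`.  Then the adversarial
calibration condition at `η = 1/2` holds: the infimum of `C(f, 1/2)` over all `f : E → ℝ`
bounded on `B` is strictly smaller than the infimum of `C(f, 1/2)` over all bounded-on-`B`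
functions satisfying `inf_B f ≤ 0 ≤ sup_B f`. -/
theorem orat_calibration_half {E : Type*} [NormedAddCommGroup E] [NormedSpace ℝ E]
    (x₀ : E) (ε : ℝ) (hε : 0 < ε)
    (ℓ : ℝ → ℝ) (hcont : Continuous ℓ) (hanti : Antitone ℓ) (hnonneg : ∀ t, 0 ≤ ℓ t)
    (hlim : Filter.Tendsto ℓ Filter.atTop (nhds 0))
    (lam lamhat : ℝ) (hlam : 0 ≤ lam) (hlt : lam < lamhat) (hsum : lam + lamhat ≤ ℓ 0) :
    sInf ((fun f : E → ℝ => innerRisk (Metric.closedBall x₀ ε) ℓ lam lamhat f (1 / 2)) ''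
        {f : E → ℝ | BddAbove (f '' Metric.closedBall x₀ ε)
          ∧ BddBelow (f '' Metric.closedBall x₀ ε)})
    < sInf ((fun f : E → ℝ => innerRisk (Metric.closedBall x₀ ε) ℓ lam lamhat f (1 / 2)) ''
        {f : E → ℝ | (BddAbove (f '' Metric.closedBall x₀ ε)
            ∧ BddBelow (f '' Metric.closedBall x₀ ε))
          ∧ sInf (f '' Metric.closedBall x₀ ε) ≤ 0
          ∧ 0 ≤ sSup (f '' Metric.closedBall x₀ ε)}) := by
  have hpos : 0 < lamhat := lt_of_le_of_lt hlam hlt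
  have hφ_nonneg : ∀ t, 0 ≤ oratLoss ℓ lam lamhat t := by
    intro t
    unfold oratLoss
    have h1 : 0 ≤ max (ℓ t - lam) 0 := le_max_right _ _
    have h2 : max (lamhat - max (ℓ t - lam) 0) 0 ≤ lamhat := max_le (by linarith) hpos.le
    linarith
  have hφ_le : ∀ t, oratLoss ℓ lam lamhat t ≤ lamhat := by
    intro t
    unfold oratLoss
    have h1 : 0 ≤ max (lamhat - max (ℓ t - lam) 0) 0 := le_max_right _ _
    linarith
  have hφ_eq : ∀ t, t ≤ 0 → oratLoss ℓ lam lamhat t = lamhat := by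
    intro t ht
    unfold oratLoss
    have h0 := hanti ht
    have h1 : ℓ t - lam ≤ max (ℓ t - lam) 0 := le_max_left _ _
    rw [max_eq_right (by linarith : lamhat - max (ℓ t - lam) 0 ≤ 0)]
    ring
  obtain ⟨T, hT⟩ : ∃ T, ℓ T < lamhat := (hlim.eventually (gt_mem_nhds hpos)).exists
  have hφT : oratLoss ℓ lam lamhat T < lamhat := by
    unfold oratLoss
    have h1 : max (ℓ T - lam) 0 < lamhat := max_lt (by linarith) hpos
    have h2 := le_max_left (lamhat - max (ℓ T - lam) 0) 0
    linarith
  have hB : (Metric.closedBall x₀ ε).Nonempty := ⟨x₀, Metric.mem_closedBall_self hε.le⟩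
  have himg : ∀ c : ℝ, (fun _ : E => c) '' Metric.closedBall x₀ ε = {c} :=
    fun c => hB.image_const c
  have hright : lamhat ≤ sInf ((fun f : E → ℝ =>
        innerRisk (Metric.closedBall x₀ ε) ℓ lam lamhat f (1 / 2)) ''
        {f : E → ℝ | (BddAbove (f '' Metric.closedBall x₀ ε)
            ∧ BddBelow (f '' Metric.closedBall x₀ ε))
          ∧ sInf (f '' Metric.closedBall x₀ ε) ≤ 0
          ∧ 0 ≤ sSup (f '' Metric.closedBall x₀ ε)}) := by
    apply le_csInf
    · refine Set.Nonempty.image _ ⟨fun _ => 0, ?_⟩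
      simp only [Set.mem_setOf_eq]
      rw [himg]
      simp
    · rintro _ ⟨f, ⟨_, h1, h2⟩, rfl⟩
      simp only [innerRisk]
      rw [hφ_eq _ h1, hφ_eq (-sSup (f '' Metric.closedBall x₀ ε)) (by linarith)]
      linarith
  refine lt_of_lt_of_le ?_ hright
  refine lt_of_le_of_lt (csInf_le ?_ ⟨fun _ => T, ?_, rfl⟩) ?_
  · refine ⟨0, ?_⟩
    rintro _ ⟨f, _, rfl⟩
    simp only [innerRisk]
    have h1 := hφ_nonneg (sInf (f '' Metric.closedBall x₀ ε))
    have h2 := hφ_nonneg (-sSup (f '' Metric.closedBall x₀ ε))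
    linarith
  · simp only [Set.mem_setOf_eq]
    rw [himg]
    simp
  · simp only [innerRisk]
    rw [himg, csInf_singleton, csSup_singleton]
    have := hφ_le (-T)
    linarith
end

section
/- Let E be a real normed vector space, x₀ ∈ E, ε > 0, and let B be the closed ball of radius ε centered at x₀. Let ℓ : ℝ → ℝ be continuous, non-increasing, and nonnegative with ℓ(t) → 0 as t → +∞, and let λ, λ̂ be reals with 0 ≤ λ < λ̂ and λ + λ̂ ≤ ℓ(0). Then for every η with 1/2 < η ≤ 1, the infimum of C(f, η) over all functions f : E → ℝ bounded on B is strictly smaller than the infimum of C(f, η) over all functions f : E → ℝ bounded on B that satisfy inf_{x ∈ B} f(x) ≤ 0. -/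
/-- The loss is nonnegative when `λ̂ ≥ 0`. -/
theorem oratLoss_nonneg' (ℓ : ℝ → ℝ) (lam lamhat t : ℝ) (h : 0 ≤ lamhat) :
    0 ≤ oratLoss ℓ lam lamhat t := by
  unfold oratLoss
  have h1 : max (lamhat - max (ℓ t - lam) 0) 0 ≤ lamhat :=
    max_le (by linarith [le_max_right (ℓ t - lam) 0]) h
  linarith

theorem oratLoss_le_lamhat' (ℓ : ℝ → ℝ) (lam lamhat t : ℝ) :
    oratLoss ℓ lam lamhat t ≤ lamhat := by
  unfold oratLoss
  linarith [le_max_right (lamhat - max (ℓ t - lam) 0) 0]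

theorem oratLoss_le_loss' (ℓ : ℝ → ℝ) (lam lamhat t : ℝ) (hlam : 0 ≤ lam) (h : 0 ≤ ℓ t) :
    oratLoss ℓ lam lamhat t ≤ ℓ t := by
  unfold oratLoss
  have h1 : max (ℓ t - lam) 0 ≤ ℓ t := max_le (by linarith) h
  linarith [le_max_left (lamhat - max (ℓ t - lam) 0) 0]

theorem oratLoss_ge_of_nonpos' (ℓ : ℝ → ℝ) (lam lamhat t : ℝ) (h : lam + lamhat ≤ ℓ t) :
    lamhat ≤ oratLoss ℓ lam lamhat t := by
  unfold oratLoss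
  have h1 : max (lamhat - max (ℓ t - lam) 0) 0 ≤ 0 :=
    max_le (by linarith [le_max_left (ℓ t - lam) 0]) le_rfl
  linarith

/-- Let `E` be a real normed vector space, `B` the closed ball of radius
`ε > 0` around `x₀`, `ℓ : ℝ → ℝ` continuous, non-increasing and nonnegative with
`ℓ(t) → 0` as `t → +∞`, and `0 ≤ λ < λ̂` with `λ + λ̂ ≤ ℓ(0)`.  Then for every `η` with
`1/2 < η ≤ 1`, the infimum of `C(f, η)` over all `f : E → ℝ` bounded on `B` is strictly
smaller than the infimum of `C(f, η)` over all bounded-on-`B` functions satisfying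
`inf_B f ≤ 0`. -/
theorem orat_calibration_eta_gt_half {E : Type*} [NormedAddCommGroup E] [NormedSpace ℝ E]
    (x₀ : E) (ε : ℝ) (hε : 0 < ε)
    (ℓ : ℝ → ℝ) (hcont : Continuous ℓ) (hanti : Antitone ℓ) (hnonneg : ∀ t, 0 ≤ ℓ t)
    (hlim : Filter.Tendsto ℓ Filter.atTop (nhds 0))
    (lam lamhat : ℝ) (hlam : 0 ≤ lam) (hlt : lam < lamhat) (hsum : lam + lamhat ≤ ℓ 0) :
    ∀ η : ℝ, 1 / 2 < η → η ≤ 1 →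
    sInf ((fun f : E → ℝ => innerRisk (Metric.closedBall x₀ ε) ℓ lam lamhat f η) ''
        {f : E → ℝ | BddAbove (f '' Metric.closedBall x₀ ε)
          ∧ BddBelow (f '' Metric.closedBall x₀ ε)})
    < sInf ((fun f : E → ℝ => innerRisk (Metric.closedBall x₀ ε) ℓ lam lamhat f η) ''
        {f : E → ℝ | (BddAbove (f '' Metric.closedBall x₀ ε)
            ∧ BddBelow (f '' Metric.closedBall x₀ ε))
          ∧ sInf (f '' Metric.closedBall x₀ ε) ≤ 0}) := by
  intro η hη hη1
  have hpos : 0 < lamhat := lt_of_le_of_lt hlam hlt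
  have hne : (Metric.closedBall x₀ ε).Nonempty := ⟨x₀, Metric.mem_closedBall_self hε.le⟩
  have hconst : ∀ c : ℝ, (fun _ : E => c) '' Metric.closedBall x₀ ε = {c} :=
    fun c => hne.image_const c
  have hδ : 0 < (2 * η - 1) * lamhat := mul_pos (by linarith) hpos
  obtain ⟨T, hT⟩ := (hlim.eventually (gt_mem_nhds hδ)).exists
  have hub : sInf ((fun f : E → ℝ => innerRisk (Metric.closedBall x₀ ε) ℓ lam lamhat f η) ''
        {f : E → ℝ | BddAbove (f '' Metric.closedBall x₀ ε)
          ∧ BddBelow (f '' Metric.closedBall x₀ ε)}) < η * lamhat := by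
    refine lt_of_le_of_lt (csInf_le ⟨0, ?_⟩ ⟨fun _ => T, ?_, rfl⟩) ?_
    · rintro _ ⟨f, -, rfl⟩
      exact add_nonneg (mul_nonneg (by linarith) (oratLoss_nonneg' _ _ _ _ hpos.le))
        (mul_nonneg (by linarith) (oratLoss_nonneg' _ _ _ _ hpos.le))
    · simp only [Set.mem_setOf_eq, hconst]
      exact ⟨bddAbove_singleton, bddBelow_singleton⟩
    · simp only [innerRisk, hconst, csInf_singleton, csSup_singleton]
      have h1 := oratLoss_le_loss' ℓ lam lamhat T hlam (hnonneg T)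
      have h2 := oratLoss_nonneg' ℓ lam lamhat T hpos.le
      have h3 := mul_le_mul_of_nonneg_left (oratLoss_le_lamhat' ℓ lam lamhat (-T))
        (sub_nonneg.2 hη1)
      have h4 := mul_le_mul_of_nonneg_right hη1 h2
      linarith
  refine lt_of_lt_of_le hub (le_csInf ?_ ?_)
  · refine ⟨_, fun _ => 0, ?_, rfl⟩
    simp only [Set.mem_setOf_eq, hconst]
    exact ⟨⟨bddAbove_singleton, bddBelow_singleton⟩, by simp⟩
  · rintro _ ⟨f, ⟨-, hf⟩, rfl⟩
    have h1 := oratLoss_ge_of_nonpos' ℓ lam lamhat _ (hsum.trans (hanti hf))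
    have h2 := mul_le_mul_of_nonneg_left h1 (show 0 ≤ η by linarith)
    have h3 := mul_nonneg (sub_nonneg.2 hη1) (oratLoss_nonneg' ℓ lam lamhat
      (-sSup (f '' Metric.closedBall x₀ ε)) hpos.le)
    simp only [innerRisk]
    linarith
end

section
/- Let E be a real normed vector space, x₀ ∈ E, ε > 0, and let B be the closed ball of radius ε centered at x₀. Let ℓ : ℝ → ℝ be continuous, non-increasing, and nonnegative with ℓ(t) → 0 as t → +∞, and let λ, λ̂ be reals with 0 ≤ λ < λ̂ and λ + λ̂ ≤ ℓ(0). Then for every η with 0 ≤ η < 1/2, the infimum of C(f, η) over all functions f : E → ℝ bounded on B is strictly smaller than the infimum of C(f, η) over all functions f : E → ℝ bounded on B that satisfy sup_{x ∈ B} f(x) ≥ 0. -/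
/-- Let `E` be a real normed vector space, `B` the closed ball of radius
`ε > 0` around `x₀`, `ℓ : ℝ → ℝ` continuous, non-increasing and nonnegative with
`ℓ(t) → 0` as `t → +∞`, and `0 ≤ λ < λ̂` with `λ + λ̂ ≤ ℓ(0)`.  Then for every `η` with
`0 ≤ η < 1/2`, the infimum of `C(f, η)` over all `f : E → ℝ` bounded on `B` is strictly
smaller than the infimum of `C(f, η)` over all bounded-on-`B` functions satisfying
`sup_B f ≥ 0`. -/
theorem orat_calibration_eta_lt_half {E : Type*} [NormedAddCommGroup E] [NormedSpace ℝ E]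
    (x₀ : E) (ε : ℝ) (hε : 0 < ε)
    (ℓ : ℝ → ℝ) (hcont : Continuous ℓ) (hanti : Antitone ℓ) (hnonneg : ∀ t, 0 ≤ ℓ t)
    (hlim : Filter.Tendsto ℓ Filter.atTop (nhds 0))
    (lam lamhat : ℝ) (hlam : 0 ≤ lam) (hlt : lam < lamhat) (hsum : lam + lamhat ≤ ℓ 0) :
    ∀ η : ℝ, 0 ≤ η → η < 1 / 2 →
    sInf ((fun f : E → ℝ => innerRisk (Metric.closedBall x₀ ε) ℓ lam lamhat f η) ''
        {f : E → ℝ | BddAbove (f '' Metric.closedBall x₀ ε)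
          ∧ BddBelow (f '' Metric.closedBall x₀ ε)})
    < sInf ((fun f : E → ℝ => innerRisk (Metric.closedBall x₀ ε) ℓ lam lamhat f η) ''
        {f : E → ℝ | (BddAbove (f '' Metric.closedBall x₀ ε)
            ∧ BddBelow (f '' Metric.closedBall x₀ ε))
          ∧ 0 ≤ sSup (f '' Metric.closedBall x₀ ε)}) := by
  intro η h0 h1
  have hpos : 0 < lamhat := lt_of_le_of_lt hlam hlt
  have phi_nonneg : ∀ t, 0 ≤ oratLoss ℓ lam lamhat t := by
    intro t
    unfold oratLoss
    have h : max (lamhat - max (ℓ t - lam) 0) 0 ≤ lamhat :=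
      max_le (by linarith [le_max_right (ℓ t - lam) 0]) hpos.le
    linarith
  have phi_le : ∀ t, oratLoss ℓ lam lamhat t ≤ lamhat := by
    intro t
    unfold oratLoss
    linarith [le_max_right (lamhat - max (ℓ t - lam) 0) 0]
  have phi_le' : ∀ t, oratLoss ℓ lam lamhat t ≤ ℓ t := by
    intro t
    unfold oratLoss
    have h : max (ℓ t - lam) 0 ≤ ℓ t := max_le (by linarith) (hnonneg t)
    linarith [le_max_left (lamhat - max (ℓ t - lam) 0) 0]
  have phi_eq : ∀ t, t ≤ 0 → oratLoss ℓ lam lamhat t = lamhat := by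
    intro t ht
    unfold oratLoss
    have h := hanti ht
    have h2 : lamhat - max (ℓ t - lam) 0 ≤ 0 := by
      linarith [le_max_left (ℓ t - lam) 0]
    rw [max_eq_right h2, sub_zero]
  have hne : (Metric.closedBall x₀ ε).Nonempty := ⟨x₀, Metric.mem_closedBall_self hε.le⟩
  have himg : ∀ c : ℝ, (fun _ : E => c) '' Metric.closedBall x₀ ε = {c} :=
    fun c => hne.image_const c
  have hd : 0 < (1 - 2 * η) * lamhat := mul_pos (by linarith) hpos
  obtain ⟨T, hT⟩ := (hlim.eventually (gt_mem_nhds hd)).exists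
  have lower : (1 - η) * lamhat ≤
      sInf ((fun f : E → ℝ => innerRisk (Metric.closedBall x₀ ε) ℓ lam lamhat f η) ''
        {f : E → ℝ | (BddAbove (f '' Metric.closedBall x₀ ε)
            ∧ BddBelow (f '' Metric.closedBall x₀ ε))
          ∧ 0 ≤ sSup (f '' Metric.closedBall x₀ ε)}) := by
    apply le_csInf
    · refine Set.Nonempty.image _ ⟨fun _ => 0, ?_⟩
      simp only [Set.mem_setOf_eq, himg]
      simp
    · rintro _ ⟨f, ⟨_, hs⟩, rfl⟩
      simp only [innerRisk]
      rw [phi_eq (-sSup (f '' Metric.closedBall x₀ ε)) (by linarith)]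
      have := mul_nonneg h0 (phi_nonneg (sInf (f '' Metric.closedBall x₀ ε)))
      linarith
  refine lt_of_lt_of_le ?_ lower
  refine lt_of_le_of_lt (csInf_le ?_ ⟨fun _ => -T, ?_, rfl⟩) ?_
  · refine ⟨0, ?_⟩
    rintro _ ⟨f, _, rfl⟩
    exact add_nonneg (mul_nonneg h0 (phi_nonneg _)) (mul_nonneg (by linarith) (phi_nonneg _))
  · simp only [Set.mem_setOf_eq, himg]
    simp
  · simp only [innerRisk, himg, csInf_singleton, csSup_singleton, neg_neg]
    have a := mul_le_mul_of_nonneg_left (phi_le (-T)) h0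
    have b := mul_nonneg h0 (phi_nonneg T)
    have c := phi_le' T
    linarith
end
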